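/- It is undecidable whether a given ordered context-free grammar G has least parse trees, i.e., whether for every string w the set P_G(w) is empty or has a ≺_G-least element. -/

import Mathlib

namespace Ocfg

/-- A symbol: nonterminal or terminal. -/
inductive Sym (N T : Type) : Type
  | nt : N → Sym N T
  | tm : T → Sym N T

/-- An (ordered) context-free grammar: each nonterminal has an ordered
list of right-hand sides; `start` is the start nonterminal. -/
structure OCFG (N T : Type) : Type where
  prods : N → List (List (Sym N T))
  start : N

/-- Ordered ranked trees used as parse trees: terminal leaves, ε-leaves,
and internal nodes labelled by a nonterminal together with the index of
the rule applied there. -/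
inductive PTree (N T : Type) : Type
  | leaf : T → PTree N T
  | eps  : PTree N T
  | node : N → ℕ → List (PTree N T) → PTree N T

mutual
/-- `ParseFrom G A w t`: `t` is a parse tree with root nonterminal `A`
and yield `w`. -/
inductive ParseFrom {N T : Type} (G : OCFG N T) : N → List T → PTree N T → Prop
  | epsNode (A : N) (i : ℕ) :
      (G.prods A)[i]? = some [] →
      ParseFrom G A [] (PTree.node A i [PTree.eps])
  | node (A : N) (i : ℕ) (r : List (Sym N T)) (w : List T) (cs : List (PTree N T)) :
      (G.prods A)[i]? = some r → r ≠ [] → ParseSeq G r w cs →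
      ParseFrom G A w (PTree.node A i cs)

/-- `ParseSeq G r w cs`: the trees `cs` match, in order, the symbols of `r`,
with concatenated yield `w`. -/
inductive ParseSeq {N T : Type} (G : OCFG N T) : List (Sym N T) → List T → List (PTree N T) → Prop
  | nil : ParseSeq G [] [] []
  | consTm (a : T) (r : List (Sym N T)) (w : List T) (cs : List (PTree N T)) :
      ParseSeq G r w cs →
      ParseSeq G (Sym.tm a :: r) (a :: w) (PTree.leaf a :: cs)
  | consNt (A : N) (t : PTree N T) (wA : List T) (r : List (Sym N T)) (w : List T)
      (cs : List (PTree N T)) :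
      ParseFrom G A wA t → ParseSeq G r w cs →
      ParseSeq G (Sym.nt A :: r) (wA ++ w) (t :: cs)
end

/-- The set `P_G(w)` of parse trees of `w`. -/
def parseTrees {N T : Type} (G : OCFG N T) (w : List T) : Set (PTree N T) :=
  {t | ParseFrom G G.start w t}

/-- `n(t)`: the sequence of rule indices of `t`, in pre-order. -/
def PTree.idxSeq {N T : Type} : PTree N T → List ℕ
  | .leaf _ => []
  | .eps => []
  | .node _ i cs => i :: (cs.attach.map (fun c => PTree.idxSeq c.1)).flatten
decreasing_by
  have := List.sizeOf_lt_of_mem c.2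
  simp_wf
  omega

/-- The order `≺_G` on parse trees: lexicographic comparison of the
pre-order rule-index sequences. -/
def treeLT {N T : Type} (t₁ t₂ : PTree N T) : Prop :=
  List.Lex (· < ·) t₁.idxSeq t₂.idxSeq

/-- One-step derivation relation `⇒` of the underlying CFG. -/
def OCFG.Step {N T : Type} (G : OCFG N T) (u v : List (Sym N T)) : Prop :=
  ∃ (u₁ u₂ : List (Sym N T)) (A : N) (r : List (Sym N T)),
    r ∈ G.prods A ∧ u = u₁ ++ Sym.nt A :: u₂ ∧ v = u₁ ++ r ++ u₂

/-- `⇒*`. -/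
def OCFG.Derives {N T : Type} (G : OCFG N T) : List (Sym N T) → List (Sym N T) → Prop :=
  Relation.ReflTransGen G.Step

/-- A nonterminal is useful if it occurs in some sentential form derivable from
the start symbol and derives some terminal string. -/
def Useful {N T : Type} (G : OCFG N T) (A : N) : Prop :=
  (∃ u₁ u₂ : List (Sym N T), G.Derives [Sym.nt G.start] (u₁ ++ Sym.nt A :: u₂)) ∧
  (∃ w : List T, G.Derives [Sym.nt A] (w.map Sym.tm))

/-- `G` is cyclic if `A ⇒⁺ A` for some nonterminal `A`. -/
def Cyclic {N T : Type} (G : OCFG N T) : Prop :=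
  ∃ A : N, Relation.TransGen G.Step [Sym.nt A] [Sym.nt A]

/-- `G` has no ε-rules. -/
def NoEpsRules {N T : Type} (G : OCFG N T) : Prop :=
  ∀ (A : N) (r : List (Sym N T)), r ∈ G.prods A → r ≠ []

/-- A unit-rule step: `A → B` is a rule of `G`. -/
def UnitStep {N T : Type} (G : OCFG N T) (A B : N) : Prop :=
  [Sym.nt B] ∈ G.prods A

/-- `G` has a cycle of unit rules. -/
def HasUnitCycle {N T : Type} (G : OCFG N T) : Prop :=
  ∃ A : N, Relation.TransGen (UnitStep G) A A

/-- `G` is well-ordered: for every string `w`, every nonempty subset of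
`P_G(w)` has a `≺_G`-least element. -/
def WellOrderedG {N T : Type} (G : OCFG N T) : Prop :=
  ∀ (w : List T) (Φ : Set (PTree N T)), Φ ⊆ parseTrees G w → Φ.Nonempty →
    ∃ t ∈ Φ, ∀ t' ∈ Φ, t = t' ∨ treeLT t t'

/-- `t` is the `≺_G`-least parse tree of `w`. -/
def IsLeastTree {N T : Type} (G : OCFG N T) (w : List T) (t : PTree N T) : Prop :=
  ParseFrom G G.start w t ∧ ∀ t', ParseFrom G G.start w t' → t = t' ∨ treeLT t t'

/-- `G` has least parse trees. -/
def HasLeastTrees {N T : Type} (G : OCFG N T) : Prop :=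
  ∀ w : List T, (parseTrees G w).Nonempty → ∃ t, IsLeastTree G w t

/-- Derivations of a given length (number of steps). -/
inductive DerivesIn {N T : Type} (G : OCFG N T) : List (Sym N T) → List (Sym N T) → ℕ → Prop
  | refl (u : List (Sym N T)) : DerivesIn G u u 0
  | step (u v w : List (Sym N T)) (n : ℕ) :
      G.Step u v → DerivesIn G v w n → DerivesIn G u w (n + 1)

/-- Number of rule applications in a parse tree (= length of the
corresponding leftmost derivation). -/
def PTree.numRules {N T : Type} : PTree N T → ℕ
  | .leaf _ => 0
  | .eps => 0
  | .node _ _ cs => 1 + ((cs.attach.map (fun c => PTree.numRules c.1)).foldr (· + ·) 0)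
decreasing_by
  have := List.sizeOf_lt_of_mem c.2
  simp_wf
  omega

/-- Height of a tree: a single leaf has height 0. -/
def PTree.height {N T : Type} : PTree N T → ℕ
  | .leaf _ => 0
  | .eps => 0
  | .node _ _ cs => 1 + ((cs.attach.map (fun c => PTree.height c.1)).foldr max 0)
decreasing_by
  have := List.sizeOf_lt_of_mem c.2
  simp_wf
  omega

/-- The language of `G`. -/
def langOf {N T : Type} (G : OCFG N T) : Language T :=
  {w | ∃ t, ParseFrom G G.start w t}

end Ocfg

namespace Ocfg

/-- A concrete encoding of oCFGs: nonterminals and terminals are natural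
numbers, the `A`-th entry of the list gives the ordered list of right-hand
sides of the production for nonterminal `A` (`Sum.inl` codes a nonterminal,
`Sum.inr` a terminal), and nonterminal `0` is the start symbol. -/
def decodeOCFG (g : List (List (List (ℕ ⊕ ℕ)))) : OCFG ℕ ℕ :=
  ⟨fun A => (g.getD A []).map (fun r => r.map (Sum.elim Sym.nt Sym.tm)), 0⟩

end Ocfg
open Ocfg


namespace Ocfg

section General
variable {N T : Type} {G : OCFG N T}

def Gen (G : OCFG N T) (r : List (Sym N T)) (w : List T) : Prop := ∃ cs, ParseSeq G r w cs

def GenN (G : OCFG N T) (A : N) (w : List T) : Prop := ∃ t, ParseFrom G A w t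

theorem gen_nil {w : List T} : Gen G [] w ↔ w = [] := by
  constructor
  · rintro ⟨cs, h⟩; cases h; rfl
  · rintro rfl; exact ⟨_, ParseSeq.nil⟩

theorem gen_tm {a : T} {r : List (Sym N T)} {w : List T} :
    Gen G (Sym.tm a :: r) w ↔ ∃ w', w = a :: w' ∧ Gen G r w' := by
  constructor
  · rintro ⟨cs, h⟩
    cases h with
    | consTm _ _ w cs h => exact ⟨w, rfl, cs, h⟩
  · rintro ⟨w', rfl, cs, h⟩
    exact ⟨_, ParseSeq.consTm _ _ _ _ h⟩

theorem gen_nt {A : N} {r : List (Sym N T)} {w : List T} :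
    Gen G (Sym.nt A :: r) w ↔ ∃ u v, w = u ++ v ∧ GenN G A u ∧ Gen G r v := by
  constructor
  · rintro ⟨cs, h⟩
    cases h with
    | consNt _ t wA _ w cs h1 h2 => exact ⟨wA, w, rfl, ⟨t, h1⟩, cs, h2⟩
  · rintro ⟨u, v, rfl, ⟨t, h1⟩, cs, h2⟩
    exact ⟨_, ParseSeq.consNt _ _ _ _ _ _ h1 h2⟩

/-- A tree of `A` whose root uses rule `i`, as an existence statement. -/
theorem exists_parse_idx {A : N} {i : ℕ} {r : List (Sym N T)} {w : List T}
    (hi : (G.prods A)[i]? = some r) (h : Gen G r w) :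
    ∃ cs, ParseFrom G A w (PTree.node A i cs) := by
  by_cases hr : r = []
  · subst hr
    rw [gen_nil] at h
    subst h
    exact ⟨_, ParseFrom.epsNode _ _ hi⟩
  · obtain ⟨cs, h⟩ := h
    exact ⟨cs, ParseFrom.node _ _ _ _ _ hi hr h⟩

theorem parse_inv {A : N} {w : List T} {t : PTree N T} (h : ParseFrom G A w t) :
    ∃ i r cs, t = PTree.node A i cs ∧ (G.prods A)[i]? = some r ∧ Gen G r w ∧
      ((r = [] ∧ cs = [PTree.eps]) ∨ ParseSeq G r w cs) := by
  cases h with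
  | epsNode _ i h => exact ⟨i, [], _, rfl, h, gen_nil.2 rfl, Or.inl ⟨rfl, rfl⟩⟩
  | node _ i r _ cs h1 h2 h3 => exact ⟨i, r, cs, rfl, h1, ⟨cs, h3⟩, Or.inr h3⟩

theorem genN_iff {A : N} {w : List T} : GenN G A w ↔ ∃ r ∈ G.prods A, Gen G r w := by
  constructor
  · rintro ⟨t, h⟩
    obtain ⟨i, r, cs, -, h1, h2, -⟩ := parse_inv h
    exact ⟨r, List.mem_of_getElem? h1, h2⟩
  · rintro ⟨r, hr, h⟩
    obtain ⟨i, hi⟩ := List.mem_iff_getElem?.1 hr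
    obtain ⟨cs, h⟩ := exists_parse_idx hi h
    exact ⟨_, h⟩

theorem idx_node (A : N) (i : ℕ) (cs : List (PTree N T)) :
    (PTree.node A i cs).idxSeq = i :: (cs.map PTree.idxSeq).flatten := by
  rw [PTree.idxSeq]
  simp

theorem idx_leaf (a : T) : (PTree.leaf a : PTree N T).idxSeq = [] := by rw [PTree.idxSeq]

theorem idx_eps : (PTree.eps : PTree N T).idxSeq = [] := by rw [PTree.idxSeq]

theorem parse_uniq {A : N} {w : List T} {t : PTree N T} (h : ParseFrom G A w t) :
    ∀ w' t' l l', ParseFrom G A w' t' → t.idxSeq ++ l = t'.idxSeq ++ l' → t = t' ∧ l = l' := by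
  induction h using ParseFrom.rec
    (motive_2 := fun r _ cs _ => ∀ w' cs' l l', ParseSeq G r w' cs' →
      (cs.map PTree.idxSeq).flatten ++ l = (cs'.map PTree.idxSeq).flatten ++ l' →
        cs = cs' ∧ l = l') with
  | epsNode A i hi =>
    intro w' t' l l' h' he
    cases h' with
    | epsNode _ j hj =>
      simp only [idx_node, List.cons_append, List.cons.injEq] at he
      obtain ⟨rfl, he⟩ := he
      simp [idx_eps] at he
      exact ⟨rfl, he⟩
    | node _ j r _ cs hj hr hs =>
      simp only [idx_node, List.cons_append, List.cons.injEq] at he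
      obtain ⟨rfl, he⟩ := he
      rw [hi] at hj
      exact absurd (Option.some.inj hj).symm hr
  | node A i r w cs hi hr hs ih =>
    intro w' t' l l' h' he
    cases h' with
    | epsNode _ j hj =>
      simp only [idx_node, List.cons_append, List.cons.injEq] at he
      obtain ⟨rfl, he⟩ := he
      rw [hi] at hj
      exact absurd (Option.some.inj hj) hr
    | node _ j r' _ cs' hj hr' hs' =>
      simp only [idx_node, List.cons_append, List.cons.injEq] at he
      obtain ⟨rfl, he⟩ := he
      rw [hi] at hj
      obtain rfl := Option.some.inj hj
      obtain ⟨rfl, h2⟩ := ih _ _ _ _ hs' he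
      exact ⟨rfl, h2⟩
  | nil =>
    rename_i w' cs' l l' h' he
    cases h'
    simpa using he
  | consTm a r w cs hs ih =>
    rename_i w' cs' l l' h' he
    cases h' with
    | consTm _ _ w' cs' h' =>
      simp only [List.map_cons, List.flatten_cons, idx_leaf, List.nil_append] at he
      obtain ⟨rfl, h2⟩ := ih _ _ _ _ h' he
      exact ⟨rfl, h2⟩
  | consNt A t wA r w cs h1 h2 ih1 ih2 =>
    rename_i w' cs' l l' h' he
    cases h' with
    | consNt _ t' _ _ _ cs' h1' h2' =>
      simp only [List.map_cons, List.flatten_cons, List.append_assoc] at he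
      obtain ⟨rfl, h3⟩ := ih1 _ _ _ _ h1' he
      obtain ⟨rfl, h4⟩ := ih2 _ _ _ _ h2' h3
      exact ⟨rfl, h4⟩

def ntCount : List (Sym N T) → ℕ
  | [] => 0
  | Sym.nt _ :: r => ntCount r + 1
  | Sym.tm _ :: r => ntCount r

def tmCount : List (Sym N T) → ℕ
  | [] => 0
  | Sym.nt _ :: r => tmCount r
  | Sym.tm _ :: r => tmCount r + 1

def GoodNts (good : N → Prop) (r : List (Sym N T)) : Prop := ∀ A, Sym.nt A ∈ r → good A

theorem seq_bound (good : N → Prop)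
    (hg : ∀ A, good A → ∀ r ∈ G.prods A, ntCount r ≤ 2 * tmCount r ∧ GoodNts good r)
    {r : List (Sym N T)} {w : List T} {cs : List (PTree N T)} (h : ParseSeq G r w cs) :
    GoodNts good r → (cs.map PTree.idxSeq).flatten.length + 2 * tmCount r
      ≤ 2 * w.length + ntCount r := by
  induction h using ParseSeq.rec
    (motive_1 := fun A w t _ => good A → t.idxSeq.length ≤ 2 * w.length + 1) with
  | epsNode A i hi => simp [idx_node, idx_eps]
  | node A i r w cs hi hr hs ih =>
    rename_i hA
    obtain ⟨h1, h2⟩ := hg A hA r (List.mem_of_getElem? hi)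
    have := ih h2
    rw [idx_node, List.length_cons]
    omega
  | nil => intro _; simp [tmCount]
  | consTm a r w cs hs ih =>
    intro h
    have := ih (fun A hA => h A (List.mem_cons_of_mem _ hA))
    simp only [List.map_cons, List.flatten_cons, idx_leaf, List.nil_append, tmCount, ntCount,
      List.length_cons]
    omega
  | consNt A t wA r w cs h1 h2 ih1 ih2 =>
    intro h
    have a1 := ih1 (h A (by simp))
    have := ih2 (fun A hA => h A (List.mem_cons_of_mem _ hA))
    simp only [List.map_cons, List.flatten_cons, List.length_append, tmCount, ntCount]
    omega

theorem exists_lex_least (K : ℕ) : ∀ (X : Set (List ℕ)), X.Nonempty → (∀ l ∈ X, l.length ≤ K) →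
    ∃ l ∈ X, ∀ l' ∈ X, l = l' ∨ List.Lex (· < ·) l l' := by
  induction K with
  | zero =>
    rintro X ⟨l, hl⟩ hX
    refine ⟨l, hl, fun l' hl' => Or.inl ?_⟩
    have h1 := hX l hl
    have h2 := hX l' hl'
    simp at h1 h2
    rw [h1, h2]
  | succ K ih =>
    rintro X ⟨l, hl⟩ hX
    by_cases hn : [] ∈ X
    · refine ⟨[], hn, fun l' _ => ?_⟩
      cases l' with
      | nil => exact Or.inl rfl
      | cons a l' => exact Or.inr List.Lex.nil
    · classical
      have hex : ∃ a, ∃ l, a :: l ∈ X := by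
        cases l with
        | nil => exact absurd hl hn
        | cons a l => exact ⟨a, l, hl⟩
      obtain ⟨l0, hl0, hmin⟩ := ih {l | Nat.find hex :: l ∈ X} (Nat.find_spec hex)
        (fun l hl => by simpa using hX _ hl)
      refine ⟨Nat.find hex :: l0, hl0, fun l' hl' => ?_⟩
      cases l' with
      | nil => exact absurd hl' hn
      | cons b l' =>
        have hb : Nat.find hex ≤ b := Nat.find_min' hex ⟨l', hl'⟩
        rcases hb.lt_or_eq with hb | hb
        · exact Or.inr (List.Lex.rel hb)
        · rw [← hb] at hl' ⊢
          rcases hmin l' hl' with h | h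
          · exact Or.inl (by rw [h])
          · exact Or.inr (List.Lex.cons h)

theorem lex_irrefl (l : List ℕ) : ¬ List.Lex (· < ·) l l := by
  induction l with
  | nil => intro h; cases h
  | cons a l ih =>
    intro h
    cases h with
    | cons h => exact ih h
    | rel h => exact lt_irrefl _ h

theorem lex_asymm {l l' : List ℕ} (h : List.Lex (· < ·) l l') : ¬ List.Lex (· < ·) l' l := by
  induction h with
  | nil => intro h; cases h
  | cons h ih =>
    intro h'
    cases h' with
    | cons h' => exact ih h'
    | rel h' => exact lt_irrefl _ h'
  | rel h =>
    intro h'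
    cases h' with
    | cons h' => exact lt_irrefl _ h
    | rel h' => exact lt_asymm h h'

/-- The nonterminal `U` with rules `U → U | V` produces no least tree. -/
theorem lex_loop {U V : N} (hU : G.prods U = [[Sym.nt U], [Sym.nt V]]) (n : ℕ) :
    ∀ (w : List T) (t : PTree N T), t.idxSeq.length ≤ n → ParseFrom G U w t →
      List.Lex (· < ·) (0 :: t.idxSeq) t.idxSeq := by
  induction n with
  | zero =>
    intro w t hn h
    obtain ⟨i, r, cs, rfl, hi, -, h⟩ := parse_inv h
    simp [idx_node] at hn
  | succ n ih =>
    intro w t hn h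
    obtain ⟨i, r, cs, rfl, hi, -, h⟩ := parse_inv h
    rw [hU] at hi
    match i, hi with
    | 0, hi =>
      simp at hi
      subst hi
      rcases h with h | h
      · simp at h
      · cases h with
        | consNt _ t _ _ _ cs h1 h2 =>
          cases h2
          simp only [idx_node, List.map_cons, List.map_nil, List.flatten_cons, List.flatten_nil,
            List.append_nil, List.length_cons] at hn ⊢
          exact List.Lex.cons (ih _ _ (by omega) h1)
    | 1, hi =>
      rw [idx_node]
      exact List.Lex.rel (by norm_num)
    | (i + 2), hi => simp at hi

/-- Master lemma: the start symbol has rules `R ++ [U]`, with `U → U | V`. -/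
theorem hasLeast_iff {R : List (List (Sym N T))} {U V : N} (good : N → Prop)
    (hg : ∀ A, good A → ∀ r ∈ G.prods A, ntCount r ≤ 2 * tmCount r ∧ GoodNts good r)
    (hS : G.prods G.start = R ++ [[Sym.nt U]]) (hR : ∀ r ∈ R, GoodNts good r)
    (hU : G.prods U = [[Sym.nt U], [Sym.nt V]]) :
    HasLeastTrees G ↔ ∀ w, GenN G V w → ∃ r ∈ R, Gen G r w := by
  have hUV : ∀ w, GenN G U w → GenN G V w := by
    rintro w ⟨t, h⟩
    obtain ⟨n, hn⟩ : ∃ n, n = t.idxSeq.length := ⟨_, rfl⟩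
    induction n using Nat.strong_induction_on generalizing t with
    | _ n ih =>
      obtain ⟨i, r, cs, rfl, hi, hr, h⟩ := parse_inv h
      rw [hU] at hi
      match i, hi with
      | 0, hi =>
        simp at hi
        subst hi
        rcases h with h | h
        · simp at h
        · cases h with
          | consNt _ t wA _ _ cs h1 h2 =>
            cases h2
            simp only [idx_node, List.map_cons, List.map_nil, List.flatten_cons,
              List.flatten_nil, List.append_nil, List.length_cons] at hn
            simp only [List.append_nil] at ih ⊢
            exact ih _ (by omega) t h1 rfl
      | 1, hi =>
        simp at hi
        subst hi
        obtain ⟨u, v, rfl, h1, h2⟩ := gen_nt.1 hr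
        rw [gen_nil] at h2
        subst h2
        simpa using h1
      | (i + 2), hi => simp at hi
  have hVU : ∀ w, GenN G V w → GenN G U w := by
    intro w h
    rw [genN_iff]
    refine ⟨[Sym.nt V], by simp [hU], ?_⟩
    exact gen_nt.2 ⟨w, [], by simp, h, gen_nil.2 rfl⟩
  constructor
  · intro hL w hw
    by_contra hno
    have hex : GenN G G.start w := by
      rw [genN_iff]
      exact ⟨[Sym.nt U], by simp [hS], gen_nt.2 ⟨w, [], by simp, hVU w hw, gen_nil.2 rfl⟩⟩
    obtain ⟨t, ht, hmin⟩ := hL w hex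
    obtain ⟨i, r, cs, rfl, hi, hr, h⟩ := parse_inv ht
    have hi' := hi
    rw [hS, List.getElem?_append] at hi
    split_ifs at hi with hlt
    · exact hno ⟨r, List.mem_of_getElem? hi, hr⟩
    · have : r = [Sym.nt U] := by
        have := List.mem_of_getElem? hi
        simpa using this
      subst this
      rcases h with h | h
      · simp at h
      · cases h with
        | consNt _ t wA _ _ cs h1 h2 =>
          cases h2
          have h3 : ParseFrom G U wA (PTree.node U 0 [t]) := by
            have := ParseFrom.node (G := G) U 0 [Sym.nt U] (wA ++ []) [t] (by simp [hU]) (by simp)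
              (ParseSeq.consNt _ _ _ _ _ _ h1 ParseSeq.nil)
            simpa using this
          have h4 := ParseFrom.node (G := G) G.start i [Sym.nt U] (wA ++ []) [PTree.node U 0 [t]]
            hi' (by simp)
              (ParseSeq.consNt _ _ _ _ _ _ h3 ParseSeq.nil)
          have h5 := lex_loop hU _ _ t le_rfl h1
          have h6 : List.Lex (· < ·)
              (PTree.node G.start i [PTree.node U 0 [t]]).idxSeq
              (PTree.node G.start i [t]).idxSeq := by
            simp only [idx_node, List.map_cons, List.map_nil, List.flatten_cons,
              List.flatten_nil, List.append_nil]
            exact List.Lex.cons h5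
          rcases hmin _ h4 with h7 | h7
          · rw [← h7] at h6
            exact lex_irrefl _ h6
          · exact lex_asymm h6 h7
  · intro hcov w hne
    have hw : ∃ r ∈ R, Gen G r w := by
      have : GenN G G.start w := hne
      rw [genN_iff, hS] at this
      obtain ⟨r, hr, h⟩ := this
      rcases List.mem_append.1 hr with hr | hr
      · exact ⟨r, hr, h⟩
      · simp at hr
        subst hr
        obtain ⟨u, v, rfl, h1, h2⟩ := gen_nt.1 h
        rw [gen_nil] at h2
        subst h2
        apply hcov
        simpa using hUV _ h1
    let X : Set (List ℕ) := {l | ∃ i cs, i < R.length ∧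
      ParseFrom G G.start w (PTree.node G.start i cs) ∧ l = (PTree.node G.start i cs).idxSeq}
    have hX : X.Nonempty := by
      obtain ⟨r, hr, h⟩ := hw
      obtain ⟨i, hi⟩ := List.mem_iff_getElem?.1 hr
      have hlt : i < R.length := (List.getElem?_eq_some_iff.1 hi).1
      obtain ⟨cs, h⟩ := exists_parse_idx (A := G.start) (i := i) (r := r)
        (by rw [hS, List.getElem?_append_left hlt, hi]) h
      exact ⟨_, i, cs, hlt, h, rfl⟩
    have hB : ∀ l ∈ X, l.length ≤ 1 + 2 * w.length + (R.map ntCount).sum := by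
      rintro l ⟨i, cs, hlt, h, rfl⟩
      obtain ⟨i', r, cs', he, hi, hr, h⟩ := parse_inv h
      simp only [PTree.node.injEq] at he
      obtain ⟨-, rfl, rfl⟩ := he
      rw [hS, List.getElem?_append_left hlt] at hi
      have hrR := List.mem_of_getElem? hi
      have h1 : ntCount r ≤ (R.map ntCount).sum :=
        List.single_le_sum (by simp) _ (List.mem_map_of_mem hrR)
      rcases h with ⟨-, rfl⟩ | h
      · simp [idx_node, idx_eps]; omega
      · have := seq_bound good hg h (hR r hrR)
        rw [idx_node, List.length_cons]
        omega
    obtain ⟨l, ⟨i, cs, hlt, hp, rfl⟩, hmin⟩ := exists_lex_least _ X hX hB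
    refine ⟨_, hp, fun t' ht' => ?_⟩
    obtain ⟨i', r', cs', rfl, hi', -, -⟩ := parse_inv ht'
    by_cases hlt' : i' < R.length
    · rcases hmin _ ⟨i', cs', hlt', ht', rfl⟩ with h | h
      · left
        exact (parse_uniq hp _ _ [] [] ht' (by rw [h])).1
      · exact Or.inr h
    · right
      unfold treeLT
      rw [idx_node, idx_node]
      exact List.Lex.rel (by omega)

end General

end Ocfg

namespace Ocfg

/-- Stack operations: `read k o keep` checks that the top of stack `k` is `o`
and pops it unless `keep` is set. -/
inductive SOp (K Γ : Type) : Type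
  | push : K → Γ → SOp K Γ
  | read : K → Option Γ → Bool → SOp K Γ
  | nop : SOp K Γ

/-- A multi-stack automaton given by its transitions (letters). -/
structure Sys (K Γ L : Type) : Type where
  op : L → SOp K Γ
  fin : L → Prop
  adj : L → L → Prop
  beg : L
  star : L

section Stacks
set_option linter.unusedSectionVars false
variable {K Γ L : Type} [DecidableEq K] [DecidableEq Γ]

/-- Effect of an operation on stack `i`. -/
def eff (i : K) : SOp K Γ → List Γ → Option (List Γ)
  | .push k a, s => if k = i then some (a :: s) else some s
  | .read k o keep, s =>
      if k = i then (if s.head? = o then some (if keep then s else s.tail) else none) else some s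
  | .nop, s => some s

/-- Effect of a word on stack `i`. -/
def run (op : L → SOp K Γ) (i : K) : List L → List Γ → Option (List Γ)
  | [], s => some s
  | x :: w, s => (eff i (op x) s).bind (run op i w)

variable {op : L → SOp K Γ} {i : K}

theorem run_append (u v : List L) (s : List Γ) :
    run op i (u ++ v) s = (run op i u s).bind (run op i v) := by
  induction u generalizing s with
  | nil => rfl
  | cons x u ih =>
    simp only [List.cons_append, run]
    cases eff i (op x) s with
    | none => rfl
    | some s' => simp [ih]

def Neutral (i : K) (o : SOp K Γ) : Prop :=
  (∀ a, o ≠ .push i a) ∧ (∀ a, o ≠ .read i (some a) false)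

inductive Bal (op : L → SOp K Γ) (i : K) : List L → Prop
  | nil : Bal op i []
  | neu (x : L) (w : List L) : Neutral i (op x) → Bal op i w → Bal op i (x :: w)
  | pair (x y : L) (a : Γ) (u v : List L) : op x = .push i a → op y = .read i (some a) false →
      Bal op i u → Bal op i v → Bal op i (x :: (u ++ y :: v))

theorem Bal.append {u v : List L} (hu : Bal op i u) (hv : Bal op i v) : Bal op i (u ++ v) := by
  induction hu with
  | nil => exact hv
  | neu x w h _ ih => exact Bal.neu x _ h ih
  | pair x y a u v hx hy hu _ _ ih =>
    have := Bal.pair x y a u _ hx hy hu ih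
    simpa using this

theorem eff_neutral {o : SOp K Γ} (h : Neutral i o) {s s' : List Γ} (he : eff i o s = some s') :
    s' = s := by
  cases o with
  | push k a =>
    by_cases hk : k = i
    · subst hk; exact absurd rfl (h.1 a)
    · simpa [eff, hk, eq_comm] using he
  | read k o keep =>
    by_cases hk : k = i
    · subst hk
      simp only [eff, if_true] at he
      split_ifs at he with h1 h2
      · simpa [eq_comm] using he
      · cases s with
        | nil => simpa [eq_comm] using he
        | cons a s =>
          simp at h1
          subst h1
          exact absurd (by simpa using h2) (by simpa using h.2 a)
    · simpa [eff, hk, eq_comm] using he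
  | nop => simpa [eff, eq_comm] using he

theorem Bal.run_eq {w : List L} (h : Bal op i w) : ∀ s s', run op i w s = some s' → s' = s := by
  induction h with
  | nil => intro s s' h; simpa [run, eq_comm] using h
  | neu x w hx _ ih =>
    intro s s' h
    simp only [run, Option.bind_eq_some_iff] at h
    obtain ⟨s1, h1, h2⟩ := h
    rw [ih _ _ h2, eff_neutral hx h1]
  | pair x y a u v hx hy _ _ ih1 ih2 =>
    intro s s' h
    simp only [run, run_append, Option.bind_eq_some_iff, hx, hy, eff, if_true] at h
    obtain ⟨s1, h1, s2, h2, s3, h3, h4⟩ := h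
    have e1 : s1 = a :: s := by simpa [eq_comm] using h1
    subst e1
    have e2 := ih1 _ _ h2
    subst e2
    simp at h3
    subst h3
    exact ih2 _ _ h4

theorem run_complete (n : ℕ) : ∀ (w : List L) (s : List Γ), w.length = n →
    run op i w [] = some s → (s = [] ∧ Bal op i w) ∨
      ∃ a s' p x q, s = a :: s' ∧ w = p ++ x :: q ∧ op x = .push i a ∧ Bal op i q ∧
        run op i p [] = some s' := by
  induction n using Nat.strong_induction_on with
  | _ n ih =>
    intro w s hn hw
    rcases List.eq_nil_or_concat w with rfl | ⟨w', x, rfl⟩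
    · left
      exact ⟨by simpa [run, eq_comm] using hw, Bal.nil⟩
    · rw [List.concat_eq_append] at hw hn ⊢
      simp only [run_append, run, Option.bind_eq_some_iff] at hw
      obtain ⟨s1, h1, s2, h2, h3⟩ := hw
      simp only [Option.some.injEq] at h3
      subst h3
      simp only [List.length_append, List.length_singleton] at hn
      have ih1 := ih w'.length (by omega) w' s1 rfl h1
      by_cases hneu : Neutral i (op x)
      · have := eff_neutral hneu h2
        subst this
        have hx : Bal op i [x] := Bal.neu x _ hneu Bal.nil
        rcases ih1 with ⟨rfl, hb⟩ | ⟨a, s', p, y, q, rfl, rfl, hy, hq, hp⟩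
        · exact Or.inl ⟨rfl, hb.append hx⟩
        · exact Or.inr ⟨a, s', p, y, q ++ [x], rfl, by simp, hy, hq.append hx, hp⟩
      · by_cases hpush : ∃ a, op x = .push i a
        · obtain ⟨a, ha⟩ := hpush
          rw [ha] at h2
          simp [eff] at h2
          subst h2
          exact Or.inr ⟨a, s1, w', x, [], rfl, rfl, ha, Bal.nil, h1⟩
        · have : ∃ a, op x = .read i (some a) false := by
            by_contra hc
            push Not at hpush hc
            exact hneu ⟨hpush, hc⟩
          obtain ⟨a, ha⟩ := this
          rw [ha] at h2
          simp only [eff, if_true] at h2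
          by_cases h4 : s1.head? = some a
          swap
          · simp [h4] at h2
          simp [h4] at h2
          rcases ih1 with ⟨rfl, hb⟩ | ⟨a', s', p, y, q, rfl, rfl, hy, hq, hp⟩
          · simp at h4
          · simp at h4 h2
            subst h4 h2
            have hblk : Bal op i (y :: (q ++ [x])) := Bal.pair y x a' q [] hy ha hq Bal.nil
            simp only [List.length_append, List.length_cons] at hn
            rcases ih p.length (by omega) p _ rfl hp with
              ⟨rfl, hb⟩ | ⟨b, s'', p', z, q', rfl, rfl, hz, hq', hp'⟩
            · left
              have := hb.append hblk
              exact ⟨rfl, by simpa using this⟩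
            · right
              exact ⟨b, s'', p', z, q' ++ (y :: (q ++ [x])), rfl, by simp, hz,
                hq'.append hblk, hp'⟩

def Err (op : L → SOp K Γ) (i : K) (w : List L) : Prop :=
  (∃ u x v, w = u ++ x :: v ∧ Bal op i u ∧ ∃ b keep, op x = .read i (some b) keep) ∨
  (∃ p x u y v, w = p ++ x :: (u ++ y :: v) ∧ Bal op i u ∧
    ∃ a o keep, op x = .push i a ∧ op y = .read i o keep ∧ o ≠ some a)

theorem run_none_split (w : List L) : ∀ s, run op i w s = none →
    ∃ u x v s', w = u ++ x :: v ∧ run op i u s = some s' ∧ eff i (op x) s' = none := by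
  induction w with
  | nil => intro s h; simp [run] at h
  | cons x w ih =>
    intro s h
    cases he : eff i (op x) s with
    | none => exact ⟨[], x, w, s, rfl, rfl, he⟩
    | some s1 =>
      simp only [run, he, Option.bind_some] at h
      obtain ⟨u, y, v, s', rfl, h1, h2⟩ := ih _ h
      exact ⟨x :: u, y, v, s', rfl, by simp [run, he, h1], h2⟩

theorem run_none_iff (w : List L) : run op i w [] = none ↔ Err op i w := by
  constructor
  · intro h
    obtain ⟨u, x, v, s, rfl, h1, h2⟩ := run_none_split w _ h
    cases ho : op x with
    | push k a => rw [ho] at h2; simp only [eff] at h2; split_ifs at h2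
    | nop => rw [ho] at h2; simp [eff] at h2
    | read k o keep =>
      rw [ho] at h2
      simp only [eff] at h2
      split_ifs at h2 with hk h3
      subst hk
      rcases run_complete _ u s rfl h1 with ⟨rfl, hb⟩ | ⟨a, s', p, y, q, rfl, rfl, hy, hq, hp⟩
      · left
        cases o with
        | none => simp at h3
        | some b => exact ⟨u, x, v, rfl, hb, b, keep, ho⟩
      · right
        exact ⟨p, y, q, x, v, by simp, hq, a, o, keep, hy, ho, by simpa [eq_comm] using h3⟩
  · intro h
    cases hr : run op i w [] with
    | none => rfl
    | some s =>
      exfalso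
      rcases h with ⟨u, x, v, rfl, hb, b, keep, hx⟩ |
        ⟨p, x, u, y, v, rfl, hb, a, o, keep, hx, hy, hne⟩
      · simp only [run_append, run, Option.bind_eq_some_iff] at hr
        obtain ⟨s1, h1, s2, h2, h3⟩ := hr
        have := hb.run_eq _ _ h1
        subst this
        simp [hx, eff] at h2
      · simp only [run_append, run, Option.bind_eq_some_iff, hx, hy] at hr
        obtain ⟨s1, h1, s2, h2, s3, h3, s4, h4, h5⟩ := hr
        simp only [eff, if_true, Option.some.injEq] at h2
        subst h2
        have := hb.run_eq _ _ h3
        subst this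
        simp only [eff, if_true] at h4
        rw [if_neg (show ¬ ((a :: s1).head? = o) from fun h => hne h.symm)] at h4
        exact absurd h4 (by simp)

/-- `u` is an accepting history of the automaton on input `n`. -/
def Acc (M : Sys K Γ L) (n : ℕ) (u : List L) : Prop :=
  (∃ a v, a ≠ M.star ∧ u = M.beg :: (List.replicate (n + 1) M.star ++ a :: v)) ∧
  u.IsChain M.adj ∧ (∃ v x, u = v ++ [x] ∧ M.fin x) ∧ ∀ i, run M.op i u [] ≠ none

/-- `u` shows some error. -/
def Bad (M : Sys K Γ L) (n : ℕ) (u : List L) : Prop :=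
  u = [] ∨ (∃ a v, u = a :: v ∧ a ≠ M.beg) ∨ (∃ v a, u = v ++ [a] ∧ ¬ M.fin a) ∨
  (∃ p a b v, u = p ++ a :: b :: v ∧ ¬ M.adj a b) ∨ (∃ i, Err M.op i u) ∨
  (∃ k ≤ n, ∃ a v, a ≠ M.star ∧ u = M.beg :: (List.replicate k M.star ++ a :: v)) ∨
  (∃ v, u = M.beg :: (List.replicate (n + 2) M.star ++ v))

theorem star_split (c : L) (u : List L) :
    ∃ k, u = List.replicate k c ∨ ∃ a v, a ≠ c ∧ u = List.replicate k c ++ a :: v := by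
  induction u with
  | nil => exact ⟨0, Or.inl rfl⟩
  | cons x u ih =>
    by_cases hx : x = c
    · subst hx
      obtain ⟨k, rfl | ⟨a, v, ha, rfl⟩⟩ := ih
      · exact ⟨k + 1, Or.inl rfl⟩
      · exact ⟨k + 1, Or.inr ⟨a, v, ha, rfl⟩⟩
    · exact ⟨0, Or.inr ⟨x, u, hx, rfl⟩⟩

theorem star_inj {c a : L} (ha : a ≠ c) {v : List L} : ∀ {k m : ℕ} {r : List L},
    List.replicate k c ++ a :: v = List.replicate m c ++ r → m ≤ k := by
  intro k
  induction k with
  | zero =>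
    intro m r h
    cases m with
    | zero => simp
    | succ m => simp [List.replicate_succ] at h; exact absurd h.1 ha
  | succ k ih =>
    intro m r h
    cases m with
    | zero => simp
    | succ m =>
      simp [List.replicate_succ] at h
      have := ih h
      omega

theorem isChain_iff_split (R : L → L → Prop) (u : List L) :
    u.IsChain R ↔ ¬ ∃ p a b v, u = p ++ a :: b :: v ∧ ¬ R a b := by
  rw [List.isChain_iff_forall_rel_of_append_cons_cons]
  push Not
  constructor
  · intro h p a b v he; exact h he
  · intro h a b p v he; exact h _ _ _ _ he

theorem bad_iff (M : Sys K Γ L) (hb : ¬ M.fin M.beg) (hs : ¬ M.fin M.star) (n : ℕ) (u : List L) :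
    Bad M n u ↔ ¬ Acc M n u := by
  constructor
  · rintro h ⟨⟨a, v, ha, hu⟩, hch, ⟨v', x, hx, hfx⟩, hrun⟩
    rw [isChain_iff_split] at hch
    rcases h with h | ⟨b, t, h, hne⟩ | ⟨t, b, h, hf⟩ | h | ⟨i, h⟩ | ⟨k, hk, b, t, hbs, h⟩ | ⟨t, h⟩
    · simp [hu] at h
    · rw [hu] at h
      simp at h
      exact hne h.1.symm
    · rw [hx] at h
      have := List.append_inj_right' h rfl
      simp at this
      subst this
      exact hf hfx
    · exact hch h
    · exact hrun i ((run_none_iff u).2 h)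
    · rw [hu] at h
      simp only [List.cons.injEq, true_and] at h
      have := star_inj hbs h.symm
      omega
    · rw [hu] at h
      simp only [List.cons.injEq, true_and] at h
      have := star_inj ha h
      omega
  · intro hacc
    by_contra hbad
    apply hacc
    unfold Bad at hbad
    simp only [not_or] at hbad
    obtain ⟨h1, h2, h3, h4, h5, h6, h7⟩ := hbad
    have hlast : ∀ v x, u = v ++ [x] → M.fin x := by
      intro v x h
      by_contra hf
      exact h3 ⟨v, x, h, hf⟩
    refine ⟨?_, (isChain_iff_split _ _).2 h4, ?_, ?_⟩
    · cases u with
      | nil => exact absurd rfl h1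
      | cons x u =>
        have hx : x = M.beg := by
          by_contra hx
          exact h2 ⟨x, u, rfl, hx⟩
        subst hx
        obtain ⟨k, rfl | ⟨a, v, ha, rfl⟩⟩ := star_split M.star u
        · exfalso
          cases k with
          | zero => exact hb (hlast [] _ rfl)
          | succ k =>
            refine hs (hlast (M.beg :: List.replicate k M.star) _ ?_)
            rw [List.replicate_succ']
            rfl
        · rcases lt_trichotomy k (n + 1) with hk | hk | hk
          · exact absurd ⟨k, by omega, a, v, ha, rfl⟩ h6
          · subst hk
            exact ⟨a, v, ha, rfl⟩
          · exfalso
            apply h7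
            obtain ⟨d, rfl⟩ : ∃ d, k = (n + 2) + d := ⟨k - (n + 2), by omega⟩
            refine ⟨List.replicate d M.star ++ a :: v, ?_⟩
            rw [List.replicate_add, List.append_assoc]
    · rcases List.eq_nil_or_concat u with h | ⟨v, x, h⟩
      · exact absurd h h1
      · rw [List.concat_eq_append] at h
        exact ⟨v, x, h, hlast v x h⟩
    · intro i hi
      exact h5 ⟨i, (run_none_iff u).1 hi⟩

end Stacks

end Ocfg

namespace Ocfg

section Grammar
set_option linter.unusedSectionVars false

open Classical in
/-- All elements of a finite type with a given property, as a list. -/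
noncomputable def listOf {α : Type} [Fintype α] (p : α → Prop) : List α :=
  (Finset.univ.filter p).toList

theorem mem_listOf {α : Type} [Fintype α] {p : α → Prop} {x : α} : x ∈ listOf p ↔ p x := by
  simp [listOf]

variable {K Γ L : Type} [DecidableEq K] [DecidableEq Γ] [Fintype K] [Fintype L]

/-- The code of a letter. -/
noncomputable def tau (x : L) : ℕ := Fintype.equivFin L x

theorem tau_inj : Function.Injective (tau : L → ℕ) := by
  intro x y h
  exact (Fintype.equivFin L).injective (Fin.ext h)

noncomputable def tt (x : L) : ℕ ⊕ ℕ := Sum.inr (tau x)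

noncomputable def nB (i : K) : ℕ := 5 + Fintype.equivFin K i

noncomputable def rulesA (L : Type) [Fintype L] : List (List (ℕ ⊕ ℕ)) :=
  [] :: (listOf (fun _ : L => True)).map (fun x => [tt x, Sum.inl 2])

noncomputable def rulesQ (M : Sys K Γ L) : List (List (ℕ ⊕ ℕ)) :=
  (listOf (fun x : L => x ≠ M.star)).map (fun x => [tt x, Sum.inl 2])

noncomputable def rulesB (M : Sys K Γ L) (i : K) : List (List (ℕ ⊕ ℕ)) :=
  [] :: ((listOf (fun x : L => Neutral i (M.op x))).map (fun x => [tt x, Sum.inl (nB i)]) ++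
    (listOf (fun p : L × L => ∃ a, M.op p.1 = .push i a ∧ M.op p.2 = .read i (some a) false)).map
      (fun p => [tt p.1, Sum.inl (nB i), tt p.2, Sum.inl (nB i)]))

noncomputable def fixedR (M : Sys K Γ L) : List (List (ℕ ⊕ ℕ)) :=
  [] :: ((listOf (fun x : L => x ≠ M.beg)).map (fun x => [tt x, Sum.inl 2]) ++
  ((listOf (fun x : L => ¬ M.fin x)).map (fun x => [Sum.inl 2, tt x]) ++
  ((listOf (fun p : L × L => ¬ M.adj p.1 p.2)).map
    (fun p => [Sum.inl 2, tt p.1, tt p.2, Sum.inl 2]) ++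
  ((listOf (fun p : K × L => ∃ b keep, M.op p.2 = .read p.1 (some b) keep)).map
    (fun p => [Sum.inl (nB p.1), tt p.2, Sum.inl 2]) ++
  (listOf (fun p : K × L × L => ∃ a o keep, M.op p.2.1 = .push p.1 a ∧
      M.op p.2.2 = .read p.1 o keep ∧ o ≠ some a)).map
    (fun p => [Sum.inl 2, tt p.2.1, Sum.inl (nB p.1), tt p.2.2, Sum.inl 2])))))

noncomputable def varR (M : Sys K Γ L) (n : ℕ) : List (List (ℕ ⊕ ℕ)) :=
  [tt M.beg :: (List.replicate n (Sum.inl 3) ++ [Sum.inl 4]),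
   tt M.beg :: (List.replicate (n + 2) (tt M.star) ++ [Sum.inl 2])]

noncomputable def gramRest (M : Sys K Γ L) : List (List (List (ℕ ⊕ ℕ))) :=
  [[Sum.inl 1], [Sum.inl 2]] :: rulesA L :: [[], [tt M.star]] :: rulesQ M ::
    List.ofFn (fun j => rulesB M ((Fintype.equivFin K).symm j))

noncomputable def gram (M : Sys K Γ L) (n : ℕ) : List (List (List (ℕ ⊕ ℕ))) :=
  ((fixedR M ++ varR M n) ++ [[Sum.inl 1]]) :: gramRest M

def dec (r : List (ℕ ⊕ ℕ)) : List (Sym ℕ ℕ) := r.map (Sum.elim Sym.nt Sym.tm)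

theorem dec_nil : dec [] = [] := rfl

theorem dec_inl (A : ℕ) (r : List (ℕ ⊕ ℕ)) : dec (Sum.inl A :: r) = Sym.nt A :: dec r := rfl

theorem dec_tt (x : L) (r : List (ℕ ⊕ ℕ)) : dec (tt x :: r) = Sym.tm (tau x) :: dec r := rfl

theorem dec_append (r s : List (ℕ ⊕ ℕ)) : dec (r ++ s) = dec r ++ dec s := by simp [dec]

variable (M : Sys K Γ L) (n : ℕ)

noncomputable abbrev GG : OCFG ℕ ℕ := decodeOCFG (gram M n)

theorem prods0 : (GG M n).prods 0 = (fixedR M ++ varR M n).map dec ++ [[Sym.nt 1]] := by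
  simp only [decodeOCFG, gram, List.getD_cons_zero, List.map_append]
  rfl

theorem prods1 : (GG M n).prods 1 = [[Sym.nt 1], [Sym.nt 2]] := rfl
theorem prods2 : (GG M n).prods 2 = (rulesA L).map dec := rfl
theorem prods3 : (GG M n).prods 3 = [[], [Sym.tm (tau M.star)]] := rfl
theorem prods4 : (GG M n).prods 4 = (rulesQ M).map dec := rfl
theorem prodsB (i : K) : (GG M n).prods (nB i) = (rulesB M i).map dec := by
  have : (gram M n).getD (nB i) [] = rulesB M i := by
    rw [nB, add_comm]
    simp [gram, gramRest, List.getD_eq_getElem?_getD]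
  show ((gram M n).getD (nB i) []).map _ = _
  rw [this]
  rfl

theorem prods_ge (A : ℕ) (h : 5 ≤ A) (r : List (Sym ℕ ℕ)) (hr : r ∈ (GG M n).prods A) :
    ∃ i : K, A = nB i := by
  by_cases hA : A - 5 < Fintype.card K
  · refine ⟨(Fintype.equivFin K).symm ⟨A - 5, hA⟩, ?_⟩
    simp [nB]
    omega
  · exfalso
    have : (gram M n).getD A [] = [] := by
      rw [List.getD_eq_default]
      simp [gram, gramRest]
      omega
    have h2 : r ∈ ((gram M n).getD A []).map dec := hr
    rw [this] at h2
    simp at h2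

theorem genA {w : List ℕ} : GenN (GG M n) 2 w ↔ ∃ u : List L, w = u.map tau := by
  constructor
  · intro h
    induction hl : w.length using Nat.strong_induction_on generalizing w with
    | _ m ih =>
      rw [genN_iff, prods2] at h
      obtain ⟨r, hr, h⟩ := h
      simp only [rulesA, List.map_cons, List.map_map, List.mem_cons, List.mem_map,
        mem_listOf] at hr
      rcases hr with rfl | ⟨x, -, rfl⟩
      · rw [dec_nil, gen_nil] at h
        exact ⟨[], h⟩
      · simp only [Function.comp, dec_tt, dec_inl, dec_nil, gen_tm, gen_nt, gen_nil] at h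
        obtain ⟨w', rfl, u, v, rfl, h, rfl⟩ := h
        obtain ⟨u', rfl⟩ := ih _ (by simp at hl; omega) h rfl
        exact ⟨x :: u', by simp⟩
  · rintro ⟨u, rfl⟩
    induction u with
    | nil =>
      rw [genN_iff, prods2]
      exact ⟨[], by simp [rulesA, dec_nil], gen_nil.2 rfl⟩
    | cons x u ih =>
      rw [genN_iff, prods2]
      refine ⟨dec [tt x, Sum.inl 2], ?_, ?_⟩
      · apply List.mem_map_of_mem
        simp only [rulesA, List.mem_cons, List.mem_map, mem_listOf]
        exact Or.inr ⟨x, trivial, rfl⟩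
      · simp only [dec_tt, dec_inl, dec_nil, gen_tm, gen_nt, gen_nil]
        exact ⟨_, rfl, _, _, by simp, ih, rfl⟩

theorem genP {w : List ℕ} : GenN (GG M n) 3 w ↔ w = [] ∨ w = [tau M.star] := by
  rw [genN_iff, prods3]
  simp [gen_nil, gen_tm]

theorem genQ {w : List ℕ} :
    GenN (GG M n) 4 w ↔ ∃ a, a ≠ M.star ∧ ∃ v : List L, w = (a :: v).map tau := by
  rw [genN_iff, prods4]
  constructor
  · rintro ⟨r, hr, h⟩
    simp only [rulesQ, List.map_map, List.mem_map, mem_listOf] at hr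
    obtain ⟨a, ha, rfl⟩ := hr
    simp only [Function.comp, dec_tt, dec_inl, dec_nil, gen_tm, gen_nt, gen_nil, genA] at h
    obtain ⟨w', rfl, u, v, rfl, ⟨u', rfl⟩, rfl⟩ := h
    exact ⟨a, ha, u', by simp⟩
  · rintro ⟨a, ha, v, rfl⟩
    refine ⟨dec [tt a, Sum.inl 2], ?_, ?_⟩
    · apply List.mem_map_of_mem
      simp only [rulesQ, List.mem_map, mem_listOf]
      exact ⟨a, ha, rfl⟩
    · simp only [dec_tt, dec_inl, dec_nil, gen_tm, gen_nt, gen_nil, genA]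
      exact ⟨_, rfl, _, _, by simp, ⟨v, rfl⟩, rfl⟩

theorem genB {i : K} {w : List ℕ} :
    GenN (GG M n) (nB i) w ↔ ∃ u : List L, Bal M.op i u ∧ w = u.map tau := by
  constructor
  · intro h
    induction hl : w.length using Nat.strong_induction_on generalizing w with
    | _ m ih =>
      rw [genN_iff, prodsB] at h
      obtain ⟨r, hr, h⟩ := h
      simp only [rulesB, List.map_cons, List.map_append, List.map_map, List.mem_cons,
        List.mem_append, List.mem_map, mem_listOf] at hr
      rcases hr with rfl | ⟨x, hx, rfl⟩ | ⟨⟨x, y⟩, ⟨a, hx, hy⟩, rfl⟩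
      · rw [dec_nil, gen_nil] at h
        exact ⟨[], Bal.nil, h⟩
      · simp only [Function.comp, dec_tt, dec_inl, dec_nil, gen_tm, gen_nt, gen_nil] at h
        obtain ⟨w', rfl, u, v, rfl, h, rfl⟩ := h
        obtain ⟨u', hu', rfl⟩ := ih _ (by simp at hl; omega) h rfl
        exact ⟨x :: u', Bal.neu _ _ hx hu', by simp⟩
      · simp only [Function.comp, dec_tt, dec_inl, dec_nil, gen_tm, gen_nt, gen_nil] at h
        obtain ⟨w', rfl, u, v, rfl, h, w'', rfl, u2, v2, rfl, h2, rfl⟩ := h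
        obtain ⟨u', hu', rfl⟩ := ih _ (by simp at hl; omega) h rfl
        obtain ⟨u2', hu2', rfl⟩ := ih _ (by simp at hl; omega) h2 rfl
        exact ⟨_, Bal.pair x y a u' u2' hx hy hu' hu2', by simp⟩
  · rintro ⟨u, hu, rfl⟩
    induction hu with
    | nil =>
      rw [genN_iff, prodsB]
      exact ⟨[], by simp [rulesB, dec_nil], gen_nil.2 rfl⟩
    | neu x u hx _ ih =>
      rw [genN_iff, prodsB]
      refine ⟨dec [tt x, Sum.inl (nB i)], ?_, ?_⟩
      · apply List.mem_map_of_mem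
        simp only [rulesB, List.mem_cons, List.mem_append, List.mem_map, mem_listOf]
        exact Or.inr (Or.inl ⟨x, hx, rfl⟩)
      · simp only [dec_tt, dec_inl, dec_nil, gen_tm, gen_nt, gen_nil]
        exact ⟨_, rfl, _, _, by simp, ih, rfl⟩
    | pair x y a u v hx hy _ _ ih1 ih2 =>
      rw [genN_iff, prodsB]
      refine ⟨dec [tt x, Sum.inl (nB i), tt y, Sum.inl (nB i)], ?_, ?_⟩
      · apply List.mem_map_of_mem
        simp only [rulesB, List.mem_cons, List.mem_append, List.mem_map, mem_listOf]
        exact Or.inr (Or.inr ⟨(x, y), ⟨a, hx, hy⟩, rfl⟩)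
      · simp only [dec_tt, dec_inl, dec_nil, gen_tm, gen_nt, gen_nil]
        exact ⟨u.map tau ++ tau y :: v.map tau, by simp, u.map tau, tau y :: v.map tau, rfl, ih1,
          v.map tau, rfl, v.map tau, [], by simp, ih2, rfl⟩

theorem gen_tms {G : OCFG ℕ ℕ} {r : List (ℕ ⊕ ℕ)} {x : L} {m : ℕ} {w : List ℕ} :
    Gen G (dec (List.replicate m (tt x) ++ r)) w ↔
      ∃ v, w = (List.replicate m x).map tau ++ v ∧ Gen G (dec r) v := by
  induction m generalizing w with
  | zero => simp
  | succ m ih =>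
    simp only [List.replicate_succ, List.cons_append, dec_tt, gen_tm, ih]
    constructor
    · rintro ⟨w', rfl, v, rfl, h⟩
      exact ⟨v, by simp, h⟩
    · rintro ⟨v, rfl, h⟩
      exact ⟨_, by simp; rfl, v, by simp, h⟩

theorem gen_Ps {r : List (ℕ ⊕ ℕ)} {m : ℕ} {w : List ℕ} :
    Gen (GG M n) (dec (List.replicate m (Sum.inl 3) ++ r)) w ↔
      ∃ k ≤ m, ∃ v, w = (List.replicate k M.star).map tau ++ v ∧ Gen (GG M n) (dec r) v := by
  induction m generalizing w with
  | zero => simp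
  | succ m ih =>
    simp only [List.replicate_succ, List.cons_append, dec_inl, gen_nt, genP, ih]
    constructor
    · rintro ⟨u, w', rfl, hu, k, hk, v, rfl, h⟩
      rcases hu with rfl | rfl
      · exact ⟨k, by omega, v, by simp, h⟩
      · exact ⟨k + 1, by omega, v, by simp [List.replicate_succ], h⟩
    · rintro ⟨k, hk, v, rfl, h⟩
      cases k with
      | zero => exact ⟨[], v, by simp, Or.inl rfl, 0, by omega, v, by simp, h⟩
      | succ k =>
        exact ⟨[tau M.star], (List.replicate k M.star).map tau ++ v,
          by simp [List.replicate_succ], Or.inr rfl, k, by omega, v, rfl, h⟩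

/-- Some error rule generates `w`. -/
def GenR (w : List ℕ) : Prop := ∃ r ∈ (fixedR M ++ varR M n).map dec, Gen (GG M n) r w

theorem gen_bad {w : List ℕ} : (∃ r ∈ (fixedR M ++ varR M n).map dec, Gen (GG M n) r w) ↔
    ∃ u : List L, w = u.map tau ∧ Bad M n u := by
  constructor
  · rintro ⟨r, hr, h⟩
    simp only [fixedR, varR, List.mem_map, List.mem_cons, List.mem_append, mem_listOf,
      List.not_mem_nil, or_false] at hr
    obtain ⟨r, (rfl | ⟨x, hx, rfl⟩ | ⟨x, hx, rfl⟩ | ⟨⟨x, y⟩, hx, rfl⟩ | ⟨⟨i, x⟩, hx, rfl⟩ |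
      ⟨⟨i, x, y⟩, hx, rfl⟩) | rfl | rfl, rfl⟩ := hr
    · rw [dec_nil, gen_nil] at h
      exact ⟨[], h, Or.inl rfl⟩
    · simp only [dec_tt, dec_inl, dec_nil, gen_tm, gen_nt, gen_nil, genA] at h
      obtain ⟨w', rfl, u, v, rfl, ⟨u', rfl⟩, rfl⟩ := h
      exact ⟨x :: u', by simp, Or.inr (Or.inl ⟨x, u', rfl, hx⟩)⟩
    · simp only [dec_tt, dec_inl, dec_nil, gen_tm, gen_nt, gen_nil, genA] at h
      obtain ⟨u, v, rfl, ⟨u', rfl⟩, _, rfl, rfl⟩ := h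
      exact ⟨u' ++ [x], by simp, Or.inr (Or.inr (Or.inl ⟨u', x, rfl, hx⟩))⟩
    · simp only [dec_tt, dec_inl, dec_nil, gen_tm, gen_nt, gen_nil, genA] at h
      obtain ⟨_, v, rfl, ⟨u', rfl⟩, _, rfl, _, rfl, _, _, rfl, ⟨v', rfl⟩, rfl⟩ := h
      exact ⟨u' ++ x :: y :: v', by simp,
        Or.inr (Or.inr (Or.inr (Or.inl ⟨u', x, y, v', rfl, hx⟩)))⟩
    · simp only [dec_tt, dec_inl, dec_nil, gen_tm, gen_nt, gen_nil, genA, genB] at h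
      obtain ⟨_, v, rfl, ⟨u', hu', rfl⟩, _, rfl, _, _, rfl, ⟨v', rfl⟩, rfl⟩ := h
      exact ⟨u' ++ x :: v', by simp,
        Or.inr (Or.inr (Or.inr (Or.inr (Or.inl ⟨i, Or.inl ⟨u', x, v', rfl, hu', hx⟩⟩))))⟩
    · simp only [dec_tt, dec_inl, dec_nil, gen_tm, gen_nt, gen_nil, genA, genB] at h
      obtain ⟨_, _, rfl, ⟨p', rfl⟩, _, rfl, _, v, rfl, ⟨u', hu', rfl⟩, _, rfl, _, _, rfl,
        ⟨v', rfl⟩, rfl⟩ := h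
      exact ⟨p' ++ x :: (u' ++ y :: v'), by simp,
        Or.inr (Or.inr (Or.inr (Or.inr (Or.inl
          ⟨i, Or.inr ⟨p', x, u', y, v', rfl, hu', hx⟩⟩))))⟩
    · simp only [dec_tt, gen_tm, gen_Ps] at h
      simp only [dec_inl, dec_nil, gen_nt, gen_nil, genQ] at h
      obtain ⟨_, rfl, k, hk, _, rfl, _, _, rfl, ⟨a, ha, v, rfl⟩, rfl⟩ := h
      exact ⟨M.beg :: (List.replicate k M.star ++ a :: v), by simp,
        Or.inr (Or.inr (Or.inr (Or.inr (Or.inr (Or.inl ⟨k, hk, a, v, ha, rfl⟩)))))⟩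
    · rw [dec_tt] at h
      simp only [gen_tm, gen_tms] at h
      simp only [dec_inl, dec_nil, gen_nt, gen_nil, genA] at h
      obtain ⟨_, rfl, _, rfl, _, _, rfl, ⟨v, rfl⟩, rfl⟩ := h
      exact ⟨M.beg :: (List.replicate (n + 2) M.star ++ v), by simp,
        Or.inr (Or.inr (Or.inr (Or.inr (Or.inr (Or.inr ⟨v, rfl⟩)))))⟩
  · rintro ⟨u, rfl, h⟩
    have key : ∀ r, r ∈ fixedR M ++ varR M n → Gen (GG M n) (dec r) (u.map tau) →
        GenR M n (u.map tau) :=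
      fun r hr h => ⟨_, List.mem_map_of_mem hr, h⟩
    simp only [fixedR, varR, List.mem_cons, List.mem_append, List.mem_map, mem_listOf,
      List.not_mem_nil, or_false] at key
    change GenR M n _
    rcases h with rfl | ⟨a, v, rfl, ha⟩ | ⟨v, a, rfl, ha⟩ | ⟨p, a, b, v, rfl, hab⟩ |
      ⟨i, ⟨u, x, v, rfl, hu, hx⟩ | ⟨p, x, u, y, v, rfl, hu, hx⟩⟩ | ⟨k, hk, a, v, ha, rfl⟩ | ⟨v, rfl⟩
    · exact key [] (Or.inl (Or.inl rfl)) (gen_nil.2 rfl)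
    · refine key _ (Or.inl (Or.inr (Or.inl ⟨a, ha, rfl⟩))) ?_
      simp only [dec_tt, dec_inl, dec_nil, gen_tm, gen_nt, gen_nil, genA]
      exact ⟨v.map tau, by simp, v.map tau, [], by simp, ⟨v, rfl⟩, rfl⟩
    · refine key _ (Or.inl (Or.inr (Or.inr (Or.inl ⟨a, ha, rfl⟩)))) ?_
      simp only [dec_tt, dec_inl, dec_nil, gen_tm, gen_nt, gen_nil, genA]
      exact ⟨v.map tau, [tau a], by simp, ⟨v, rfl⟩, [], rfl, rfl⟩
    · refine key _ (Or.inl (Or.inr (Or.inr (Or.inr (Or.inl ⟨(a, b), hab, rfl⟩))))) ?_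
      simp only [dec_tt, dec_inl, dec_nil, gen_tm, gen_nt, gen_nil, genA]
      exact ⟨p.map tau, _, by simp; rfl, ⟨p, rfl⟩, _, rfl, _, rfl, v.map tau, [], by simp,
        ⟨v, rfl⟩, rfl⟩
    · refine key _ (Or.inl (Or.inr (Or.inr (Or.inr (Or.inr (Or.inl ⟨(i, x), hx, rfl⟩)))))) ?_
      simp only [dec_tt, dec_inl, dec_nil, gen_tm, gen_nt, gen_nil, genA, genB]
      exact ⟨u.map tau, _, by simp; rfl, ⟨u, hu, rfl⟩, _, rfl, v.map tau, [], by simp,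
        ⟨v, rfl⟩, rfl⟩
    · refine key _ (Or.inl (Or.inr (Or.inr (Or.inr (Or.inr (Or.inr ⟨(i, x, y), hx, rfl⟩)))))) ?_
      simp only [dec_tt, dec_inl, dec_nil, gen_tm, gen_nt, gen_nil, genA, genB]
      exact ⟨p.map tau, tau x :: (u.map tau ++ tau y :: v.map tau), by simp, ⟨p, rfl⟩, _, rfl,
        u.map tau, _, rfl, ⟨u, hu, rfl⟩, _, rfl, v.map tau, [], by simp, ⟨v, rfl⟩, rfl⟩
    · refine key _ (Or.inr (Or.inl rfl)) ?_
      simp only [dec_tt, gen_tm, gen_Ps]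
      simp only [dec_inl, dec_nil, gen_nt, gen_nil, genQ]
      exact ⟨_, by simp; rfl, k, hk, (a :: v).map tau, by simp, (a :: v).map tau, [], by simp,
        ⟨a, ha, v, rfl⟩, rfl⟩
    · refine key _ (Or.inr (Or.inr rfl)) ?_
      rw [dec_tt]
      simp only [gen_tm, gen_tms]
      simp only [dec_inl, dec_nil, gen_nt, gen_nil, genA]
      exact ⟨(List.replicate (n + 2) M.star).map tau ++ v.map tau, by simp, v.map tau, rfl,
        v.map tau, [], by simp, ⟨v, rfl⟩, rfl⟩

theorem nB_ge (i : K) : 2 ≤ nB i := by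
  unfold nB; omega

/-- The key reduction. -/
theorem gram_spec (hb : ¬ M.fin M.beg) (hs : ¬ M.fin M.star) :
    HasLeastTrees (decodeOCFG (gram M n)) ↔ ¬ ∃ u, Acc M n u := by
  have hgood2 : ∀ x : L, GoodNts (fun A => 2 ≤ A) (dec [tt x, Sum.inl 2]) := by
    intro x A hA
    simp [dec_tt, dec_inl, dec_nil] at hA
    omega
  rw [hasLeast_iff (G := GG M n) (R := (fixedR M ++ varR M n).map dec) (U := 1) (V := 2)
    (fun A => 2 ≤ A) ?_ (prods0 M n) ?_ (prods1 M n)]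
  · constructor
    · rintro h ⟨u, hu⟩
      obtain ⟨u', he, hbad⟩ := (gen_bad M n).1 (h (u.map tau) ((genA M n).2 ⟨u, rfl⟩))
      have := List.map_injective_iff.2 tau_inj he
      subst this
      exact (bad_iff M hb hs n _).1 hbad hu
    · intro h w hw
      obtain ⟨u, rfl⟩ := (genA M n).1 hw
      exact (gen_bad M n).2 ⟨u, rfl, (bad_iff M hb hs n _).2 (fun hu => h ⟨u, hu⟩)⟩
  · intro A hA r hr
    rcases (by omega : A = 2 ∨ A = 3 ∨ A = 4 ∨ 5 ≤ A) with rfl | rfl | rfl | h5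
    · rw [prods2] at hr
      simp only [rulesA, List.map_cons, List.map_map, List.mem_cons, List.mem_map,
        mem_listOf] at hr
      rcases hr with rfl | ⟨x, -, rfl⟩
      · exact ⟨by simp [dec_nil, ntCount], by simp [dec_nil, GoodNts]⟩
      · exact ⟨by simp [dec_nil, dec_tt, dec_inl, ntCount, tmCount], hgood2 x⟩
    · rw [prods3] at hr
      simp at hr
      rcases hr with rfl | rfl
      · exact ⟨by simp [ntCount], by simp [GoodNts]⟩
      · exact ⟨by simp [ntCount], by simp [GoodNts]⟩
    · rw [prods4] at hr
      simp only [rulesQ, List.map_map, List.mem_map, mem_listOf] at hr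
      obtain ⟨x, -, rfl⟩ := hr
      exact ⟨by simp [dec_nil, dec_tt, dec_inl, ntCount, tmCount], hgood2 x⟩
    · obtain ⟨i, rfl⟩ := prods_ge M n A h5 r hr
      rw [prodsB] at hr
      simp only [rulesB, List.map_cons, List.map_append, List.map_map, List.mem_cons,
        List.mem_append, List.mem_map, mem_listOf] at hr
      rcases hr with rfl | ⟨x, hx, rfl⟩ | ⟨⟨x, y⟩, ⟨a, hx, hy⟩, rfl⟩
      · exact ⟨by simp [dec_nil, ntCount], by simp [dec_nil, GoodNts]⟩
      · exact ⟨by simp [dec_nil, dec_tt, dec_inl, ntCount, tmCount],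
          by simp [dec_nil, dec_tt, dec_inl, GoodNts, nB_ge]⟩
      · exact ⟨by simp [dec_nil, dec_tt, dec_inl, ntCount, tmCount],
          by simp [dec_nil, dec_tt, dec_inl, GoodNts, nB_ge]⟩
  · intro r hr
    simp only [fixedR, varR, List.mem_map, List.mem_cons, List.mem_append, mem_listOf,
      List.not_mem_nil, or_false] at hr
    obtain ⟨r, (rfl | ⟨x, hx, rfl⟩ | ⟨x, hx, rfl⟩ | ⟨⟨x, y⟩, hx, rfl⟩ | ⟨⟨i, x⟩, hx, rfl⟩ |
      ⟨⟨i, x, y⟩, hx, rfl⟩) | rfl | rfl, rfl⟩ := hr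
    · simp [dec_nil, GoodNts]
    · exact hgood2 x
    · simp [dec_nil, dec_tt, dec_inl, GoodNts]
    · simp [dec_nil, dec_tt, dec_inl, GoodNts]
    · simp [dec_nil, dec_tt, dec_inl, GoodNts, nB_ge]
    · simp [dec_nil, dec_tt, dec_inl, GoodNts, nB_ge]
    · intro A hA
      simp [dec, tt] at hA
      omega
    · intro A hA
      simp [dec, tt] at hA
      omega

end Grammar

end Ocfg

namespace Ocfg

section Paths
variable {L Q : Type}

/-- A word is a path from the state `s` that ends in a final letter. -/
def Path (src tgt : L → Q) (fin : L → Prop) : List L → Q → Prop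
  | [], _ => False
  | x :: w, s => src x = s ∧ (Path src tgt fin w (tgt x) ∨ (w = [] ∧ fin x))

theorem path_iff (src tgt : L → Q) (fin : L → Prop) (w : List L) (s : Q) :
    Path src tgt fin w s ↔ (∃ x w', w = x :: w' ∧ src x = s) ∧
      w.IsChain (fun a b => tgt a = src b) ∧ ∃ v x, w = v ++ [x] ∧ fin x := by
  induction w generalizing s with
  | nil => simp [Path]
  | cons x w ih =>
    cases w with
    | nil =>
      simp only [Path, false_or, true_and]
      constructor
      · rintro ⟨h1, h2⟩
        exact ⟨⟨x, [], rfl, h1⟩, by simp, [], x, rfl, h2⟩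
      · rintro ⟨⟨x', w', h, h1⟩, -, v, y, h3, h4⟩
        simp only [List.cons.injEq] at h
        obtain ⟨rfl, -⟩ := h
        rcases v with _ | ⟨z, v⟩
        · simp at h3; subst h3; exact ⟨h1, h4⟩
        · simp at h3
    | cons y w =>
      rw [Path, ih, List.isChain_cons_cons]
      constructor
      · rintro ⟨h1, ⟨⟨y', w', h, h2⟩, h3, v, z, h4, h5⟩ | ⟨h, -⟩⟩
        · simp only [List.cons.injEq] at h
          obtain ⟨rfl, -⟩ := h
          exact ⟨⟨x, _, rfl, h1⟩, ⟨h2.symm, h3⟩, x :: v, z, by simp [h4], h5⟩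
        · simp at h
      · rintro ⟨⟨x', w', h, h1⟩, ⟨h2, h3⟩, v, z, h4, h5⟩
        simp only [List.cons.injEq] at h
        obtain ⟨rfl, -⟩ := h
        refine ⟨h1, Or.inl ⟨⟨y, w, rfl, h2.symm⟩, h3, ?_⟩⟩
        rcases v with _ | ⟨x', v⟩
        · simp at h4
        · simp at h4
          exact ⟨v, z, h4.2, h5⟩

end Paths

section Machine
open Turing
set_option linter.unusedSectionVars false
variable {K Γ Λ σ : Type} [DecidableEq K] [DecidableEq Γ]

/-- Control states of the automaton. -/
inductive St (Q σ : Type) : Type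
  | s0 : St Q σ
  | s1 : St Q σ
  | m : Q → σ → St Q σ

/-- Letters: three loading letters and the machine transitions. -/
abbrev Let (Γ σ : Type) {Q : Type} (P : Finset Q) : Type := Fin 3 ⊕ ({q // q ∈ P} × σ × Option Γ)

variable (tr : Λ → TM2.Stmt (fun _ : K => Γ) Λ σ)

def nxt : TM2.Stmt (fun _ : K => Γ) Λ σ → σ → Option Γ →
    St (TM2.Stmt (fun _ : K => Γ) Λ σ) σ
  | .push _ _ q, v, _ => .m q v
  | .peek _ f q, v, o => .m q (f v o)
  | .pop _ f q, v, o => .m q (f v o)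
  | .load a q, v, _ => .m q (a v)
  | .branch f q₁ q₂, v, _ => .m (cond (f v) q₁ q₂) v
  | .goto l, v, _ => .m (tr (l v)) v
  | .halt, _, _ => .s0

def opS : TM2.Stmt (fun _ : K => Γ) Λ σ → σ → Option Γ → SOp K Γ
  | .push k f _, v, _ => .push k (f v)
  | .peek k _ _, _, o => .read k o true
  | .pop k _ _, _, o => .read k o false
  | .load _ _, _, _ => .nop
  | .branch _ _ _, _, _ => .nop
  | .goto _, _, _ => .nop
  | .halt, _, _ => .nop

variable {P : Finset (TM2.Stmt (fun _ : K => Γ) Λ σ)}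
variable (q₀ : TM2.Stmt (fun _ : K => Γ) Λ σ) (v₀ : σ) (k₀ : K) (b₀ b₁ : Γ)

def srcL : Let Γ σ P → St (TM2.Stmt (fun _ : K => Γ) Λ σ) σ
  | .inl 0 => .s0
  | .inl 1 => .s1
  | .inl 2 => .s1
  | .inr (q, v, _) => .m q.1 v

def tgtL : Let Γ σ P → St (TM2.Stmt (fun _ : K => Γ) Λ σ) σ
  | .inl 0 => .s1
  | .inl 1 => .s1
  | .inl 2 => .m q₀ v₀
  | .inr (q, v, o) => nxt tr q.1 v o

def opL : Let Γ σ P → SOp K Γ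
  | .inl 0 => .push k₀ b₀
  | .inl 1 => .push k₀ b₁
  | .inl 2 => .nop
  | .inr (q, v, o) => opS q.1 v o

def finL : Let Γ σ P → Prop
  | .inl _ => False
  | .inr (q, _, _) => q.1 = .halt

variable (P) in
/-- The multi-stack automaton. -/
def sysOf : Sys K Γ (Let Γ σ P) where
  op := opL k₀ b₀ b₁
  fin := finL
  adj := fun a b => tgtL tr q₀ v₀ a = srcL b
  beg := .inl 0
  star := .inl 1

theorem eff_push (S : K → List Γ) (k i : K) (a : Γ) :
    eff i (.push k a) (S i) = some (Function.update S k (a :: S k) i) := by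
  by_cases h : k = i
  · subst h; simp [eff]
  · simp [eff, h, Function.update_of_ne (Ne.symm h)]

theorem eff_peek (S : K → List Γ) (k i : K) :
    eff i (.read k (S k).head? true) (S i) = some (S i) := by
  by_cases h : k = i
  · subst h; simp [eff]
  · simp [eff, h]

theorem eff_pop (S : K → List Γ) (k i : K) :
    eff i (.read k (S k).head? false) (S i) = some (Function.update S k (S k).tail i) := by
  by_cases h : k = i
  · subst h; simp [eff]
  · simp [eff, h, Function.update_of_ne (Ne.symm h)]

theorem read_head {s : List Γ} {k : K} {o : Option Γ} {b : Bool}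
    (h : eff k (.read k o b) s ≠ none) : s.head? = o := by
  simp only [eff, if_true] at h
  by_contra h1
  simp [h1] at h

theorem run_cons_ne {L : Type} {op : L → SOp K Γ} {i : K} {x : L} {w : List L} {s s' : List Γ}
    (h : eff i (op x) s = some s') : run op i (x :: w) s ≠ none ↔ run op i w s' ≠ none := by
  simp [run, h]

theorem run_cons_eff {L : Type} {op : L → SOp K Γ} {i : K} {x : L} {w : List L} {s : List Γ}
    (h : run op i (x :: w) s ≠ none) : eff i (op x) s ≠ none := by
  intro h'
  simp [run, h'] at h

theorem dom_none (v : σ) (S : K → List Γ) :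
    (StateTransition.eval (TM2.step tr) ⟨none, v, S⟩).Dom := by
  rw [Part.dom_iff_mem]
  exact ⟨_, StateTransition.mem_eval.2 ⟨Relation.ReflTransGen.refl, rfl⟩⟩

theorem dom_some (l : Λ) (v : σ) (S : K → List Γ) :
    (StateTransition.eval (TM2.step tr) ⟨some l, v, S⟩).Dom ↔
      (StateTransition.eval (TM2.step tr) (TM2.stepAux (tr l) v S)).Dom := by
  rw [StateTransition.reaches_eval (f := TM2.step tr) (b := TM2.stepAux (tr l) v S) (a := (⟨some l, v, S⟩ : TM2.Cfg (fun _ : K => Γ) Λ σ))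
    (Relation.ReflTransGen.single rfl)]

theorem sound (w : List (Let Γ σ P)) :
    ∀ (q : TM2.Stmt (fun _ : K => Γ) Λ σ) (v : σ) (S : K → List Γ),
    Path srcL (tgtL tr q₀ v₀) finL w (.m q v) →
    (∀ i, run (opL k₀ b₀ b₁) i w (S i) ≠ none) →
    (StateTransition.eval (TM2.step tr) (TM2.stepAux q v S)).Dom := by
  induction w with
  | nil => intro q v S h; exact h.elim
  | cons x w ih =>
    intro q v S hp hr
    obtain ⟨hx, hp⟩ := hp
    rcases x with j | ⟨⟨q', hq⟩, v', o⟩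
    · fin_cases j <;> simp [srcL] at hx
    simp only [srcL, St.m.injEq] at hx
    obtain ⟨rfl, rfl⟩ := hx
    have hh : q' ≠ .halt → Path srcL (tgtL tr q₀ v₀) finL w (nxt tr q' v' o) := by
      intro h
      rcases hp with hp | ⟨-, hp⟩
      · exact hp
      · exact absurd hp h
    have step : ∀ S' : K → List Γ, (∀ i, eff i (opS q' v' o) (S i) = some (S' i)) →
        ∀ i, run (opL k₀ b₀ b₁) i w (S' i) ≠ none := fun S' h i =>
      (run_cons_ne (op := opL k₀ b₀ b₁) (x := .inr (⟨q', hq⟩, v', o)) (h i)).1 (hr i)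
    cases q' with
    | push k f q =>
      exact ih q _ _ (hh (by simp)) (step _ (fun i => eff_push S k i (f v')))
    | peek k f q =>
      have ho : (S k).head? = o := by
        have := run_cons_eff (hr k)
        exact read_head (b := true) this
      subst ho
      exact ih q _ _ (hh (by simp)) (step _ (fun i => eff_peek S k i))
    | pop k f q =>
      have ho : (S k).head? = o := by
        have := run_cons_eff (hr k)
        exact read_head (b := false) this
      subst ho
      exact ih q _ _ (hh (by simp)) (step _ (fun i => eff_pop S k i))
    | load a q =>
      exact ih q _ _ (hh (by simp)) (step _ (fun i => rfl))
    | branch f q₁ q₂ =>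
      have := ih _ _ _ (hh (by simp)) (step _ (fun i => rfl))
      rw [TM2.stepAux]
      cases hf : f v' <;> simpa [hf] using this
    | goto l =>
      have := ih _ _ _ (hh (by simp)) (step _ (fun i => rfl))
      rw [TM2.stepAux, dom_some]
      exact this
    | halt => exact dom_none _ _ _

/-- There is an accepting path from the given machine state. -/
def HasPath (P : Finset (TM2.Stmt (fun _ : K => Γ) Λ σ)) (q : TM2.Stmt (fun _ : K => Γ) Λ σ)
    (v : σ) (S : K → List Γ) : Prop :=
  ∃ w : List (Let Γ σ P), Path srcL (tgtL tr q₀ v₀) finL w (.m q v) ∧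
    ∀ i, run (opL k₀ b₀ b₁) i w (S i) ≠ none

def CfgPath (P : Finset (TM2.Stmt (fun _ : K => Γ) Λ σ)) : TM2.Cfg (fun _ : K => Γ) Λ σ → Prop
  | ⟨none, _, _⟩ => True
  | ⟨some l, v, S⟩ => HasPath tr q₀ v₀ k₀ b₀ b₁ P (tr l) v S

theorem hasPath_cons {q q' : TM2.Stmt (fun _ : K => Γ) Λ σ} (hq : q ∈ P) {v v' : σ} (o : Option Γ)
    {S S' : K → List Γ} (h : nxt tr q v o = .m q' v')
    (he : ∀ i, eff i (opS q v o) (S i) = some (S' i))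
    (hp : HasPath tr q₀ v₀ k₀ b₀ b₁ P q' v' S') : HasPath tr q₀ v₀ k₀ b₀ b₁ P q v S := by
  obtain ⟨w, h1, h2⟩ := hp
  refine ⟨.inr (⟨q, hq⟩, v, o) :: w, ⟨rfl, Or.inl ?_⟩, fun i => ?_⟩
  · rw [← h] at h1; exact h1
  · exact (run_cons_ne (op := opL k₀ b₀ b₁) (x := .inr (⟨q, hq⟩, v, o)) (he i)).2 (h2 i)

theorem complete1 (q : TM2.Stmt (fun _ : K => Γ) Λ σ) : TM2.stmts₁ q ⊆ P →
    ∀ (v : σ) (S : K → List Γ), CfgPath tr q₀ v₀ k₀ b₀ b₁ P (TM2.stepAux q v S) →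
    HasPath tr q₀ v₀ k₀ b₀ b₁ P q v S := by
  classical
  intro hP
  have hq : q ∈ P := hP TM2.stmts₁_self
  induction q with
  | push k f q ih =>
    intro v S h
    have hs : TM2.stmts₁ q ⊆ P := fun x hx => hP (by simp [TM2.stmts₁, hx])
    exact hasPath_cons _ _ _ _ _ _ hq none rfl (fun i => eff_push S k i (f v))
      (ih hs (hs TM2.stmts₁_self) _ _ h)
  | peek k f q ih =>
    intro v S h
    have hs : TM2.stmts₁ q ⊆ P := fun x hx => hP (by simp [TM2.stmts₁, hx])
    exact hasPath_cons _ _ _ _ _ _ hq (S k).head? rfl (fun i => eff_peek S k i)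
      (ih hs (hs TM2.stmts₁_self) _ _ h)
  | pop k f q ih =>
    intro v S h
    have hs : TM2.stmts₁ q ⊆ P := fun x hx => hP (by simp [TM2.stmts₁, hx])
    exact hasPath_cons _ _ _ _ _ _ hq (S k).head? rfl (fun i => eff_pop S k i)
      (ih hs (hs TM2.stmts₁_self) _ _ h)
  | load a q ih =>
    intro v S h
    have hs : TM2.stmts₁ q ⊆ P := fun x hx => hP (by simp [TM2.stmts₁, hx])
    exact hasPath_cons _ _ _ _ _ _ hq none rfl (fun i => rfl)
      (ih hs (hs TM2.stmts₁_self) _ _ h)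
  | branch f q₁ q₂ ih₁ ih₂ =>
    intro v S h
    have hs₁ : TM2.stmts₁ q₁ ⊆ P := fun x hx => hP (by simp [TM2.stmts₁, hx])
    have hs₂ : TM2.stmts₁ q₂ ⊆ P := fun x hx => hP (by simp [TM2.stmts₁, hx])
    refine hasPath_cons _ _ _ _ _ _ hq none rfl (fun i => rfl) (S' := S) ?_
    rw [TM2.stepAux] at h
    cases hf : f v
    · rw [hf] at h; exact ih₂ hs₂ (hs₂ TM2.stmts₁_self) _ _ h
    · rw [hf] at h; exact ih₁ hs₁ (hs₁ TM2.stmts₁_self) _ _ h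
  | goto l =>
    intro v S h
    exact hasPath_cons _ _ _ _ _ _ hq none rfl (fun i => rfl) h
  | halt =>
    intro v S _
    exact ⟨[.inr (⟨_, hq⟩, v, none)], ⟨rfl, Or.inr ⟨rfl, rfl⟩⟩, fun i => by simp [run, eff, opL, opS]⟩

theorem complete [Inhabited Λ] {F : Finset Λ} (hF : TM2.Supports tr F)
    (hP : ∀ l ∈ F, TM2.stmts₁ (tr l) ⊆ P) (c : TM2.Cfg (fun _ : K => Γ) Λ σ)
    (hc : c.l ∈ Finset.insertNone F) (hd : (StateTransition.eval (TM2.step tr) c).Dom) :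
    CfgPath tr q₀ v₀ k₀ b₀ b₁ P c := by
  obtain ⟨d, hd'⟩ := Part.dom_iff_mem.1 hd
  obtain ⟨hr, hd1⟩ := StateTransition.mem_eval.1 hd'
  clear hd hd'
  induction hr using Relation.ReflTransGen.head_induction_on with
  | refl =>
    rcases d with ⟨_ | l, v, S⟩
    · trivial
    · simp [TM2.step] at hd1
  | @head a b h _ ih =>
    have := ih (TM2.step_supports tr hF h hc)
    rcases a with ⟨_ | l, v, S⟩
    · trivial
    · simp only [TM2.step, Option.mem_def, Option.some.injEq] at h
      subst h
      exact complete1 _ _ _ _ _ _ _ (hP l (Finset.some_mem_insertNone.1 hc)) _ _ this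

end Machine

end Ocfg

namespace Ocfg

section Accept
open Turing
set_option linter.unusedSectionVars false
variable {K Γ Λ σ : Type} [DecidableEq K] [DecidableEq Γ]
variable (tr : Λ → TM2.Stmt (fun _ : K => Γ) Λ σ)
variable {P : Finset (TM2.Stmt (fun _ : K => Γ) Λ σ)}
variable (q₀ : TM2.Stmt (fun _ : K => Γ) Λ σ) (v₀ : σ) (k₀ : K) (b₀ b₁ : Γ)

/-- Initial stacks. -/
def initS (n : ℕ) : K → List Γ :=
  Function.update (fun _ => []) k₀ (List.replicate (n + 1) b₁ ++ [b₀])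

theorem run_stars (n : ℕ) (i : K) (s : List Γ) :
    run (opL k₀ b₀ b₁ : Let Γ σ P → SOp K Γ) i (List.replicate n (.inl 1)) s =
      some (if k₀ = i then List.replicate n b₁ ++ s else s) := by
  induction n generalizing s with
  | zero => simp [run]
  | succ n ih =>
    rw [List.replicate_succ, run]
    by_cases h : k₀ = i
    · subst h
      simp only [opL, eff, if_true, Option.bind_some]
      rw [ih]
      simp [List.replicate_succ', List.append_assoc]
    · simp [opL, eff, h, ih]

theorem run_load (n : ℕ) (i : K) (w : List (Let Γ σ P)) :
    run (opL k₀ b₀ b₁) i (.inl 0 :: (List.replicate (n + 1) (.inl 1) ++ .inl 2 :: w)) [] =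
      run (opL k₀ b₀ b₁) i w (initS k₀ b₀ b₁ n i) := by
  have h0 : eff i (opL k₀ b₀ b₁ (.inl 0 : Let Γ σ P)) [] = some _ :=
    eff_push (fun _ => []) k₀ i b₀
  rw [run, h0]
  rw [Option.bind_some, run_append, run_stars, Option.bind_some, run]
  simp only [opL, eff, Option.bind_some, initS]
  by_cases h : k₀ = i
  · subst h; simp
  · simp [h, Function.update_of_ne (Ne.symm h)]

theorem path_stars (n : ℕ) (w : List (Let Γ σ P)) :
    Path srcL (tgtL tr q₀ v₀) finL (List.replicate n (.inl 1) ++ .inl 2 :: w) .s1 ↔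
      Path srcL (tgtL tr q₀ v₀) finL w (.m q₀ v₀) := by
  induction n with
  | zero => simp [Path, srcL, tgtL, finL]
  | succ n ih =>
    rw [List.replicate_succ, List.cons_append, Path]
    simp only [srcL, tgtL, finL, ih, true_and, and_false, or_false]

theorem acc_iff (n : ℕ) : (∃ u, Acc (sysOf tr P q₀ v₀ k₀ b₀ b₁) n u) ↔
    HasPath tr q₀ v₀ k₀ b₀ b₁ P q₀ v₀ (initS k₀ b₀ b₁ n) := by
  constructor
  · rintro ⟨u, ⟨a, v, ha, rfl⟩, hch, hfin, hrun⟩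
    have ha2 : a = .inl 2 := by
      have h1 : srcL a = .s1 := by
        have := hch
        rw [List.replicate_succ', List.append_assoc, ← List.cons_append] at this
        have := this.right_of_append
        simp only [List.singleton_append, List.isChain_cons_cons] at this
        exact this.1.symm
      rcases a with j | ⟨q, v, o⟩
      · fin_cases j
        · simp [srcL] at h1
        · exact absurd rfl ha
        · rfl
      · simp [srcL] at h1
    subst ha2
    refine ⟨v, ?_, fun i => ?_⟩
    · have := (path_iff srcL (tgtL tr q₀ v₀) finL _ .s0).2 ⟨⟨_, _, rfl, rfl⟩, hch, hfin⟩
      rcases this.2 with h | ⟨h, -⟩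
      · exact (path_stars tr q₀ v₀ _ v).1 h
      · simp at h
    · rw [← run_load]
      exact hrun i
  · rintro ⟨v, hp, hr⟩
    have hp' := (path_iff srcL (tgtL tr q₀ v₀) finL
      (.inl 0 :: (List.replicate (n + 1) (.inl 1) ++ .inl 2 :: v)) .s0).1
      ⟨rfl, Or.inl ((path_stars tr q₀ v₀ (n + 1) v).2 hp)⟩
    refine ⟨_, ⟨.inl 2, v, ?_, rfl⟩, hp'.2.1, hp'.2.2, fun i => ?_⟩
    · simp [sysOf]
    · have := hr i
      rw [← run_load] at this
      exact this

end Accept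

section Universal
open Turing Turing.PartrecToTM2

theorem trPosNum_ones (n : ℕ) : ∃ p : PosNum, (p : ℕ) = 2 ^ (n + 1) - 1 ∧
    trPosNum p = List.replicate (n + 1) Γ'.bit1 := by
  induction n with
  | zero => exact ⟨PosNum.one, rfl, rfl⟩
  | succ n ih =>
    obtain ⟨p, h1, h2⟩ := ih
    refine ⟨PosNum.bit1 p, ?_, ?_⟩
    · rw [PosNum.cast_bit1, h1]
      have : 0 < 2 ^ (n + 1) := by positivity
      rw [pow_succ 2 (n + 1)]
      omega
    · rw [trPosNum, h2, List.replicate_succ (n := n + 1)]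

theorem trNat_ones (n : ℕ) : trNat (2 ^ (n + 1) - 1) = List.replicate (n + 1) Γ'.bit1 := by
  obtain ⟨p, h1, h2⟩ := trPosNum_ones n
  rw [← h1, trNat, ← h2]
  have : ((p : ℕ) : Num) = Num.pos p := by
    simp
  rw [this]
  rfl

noncomputable instance : Fintype K' :=
  ⟨{.main, .rev, .aux, .stack}, fun x => by cases x <;> simp⟩

open Classical in
noncomputable def stSet (c : ToPartrec.Code) :
    Finset (TM2.Stmt (fun _ : K' => Γ') Λ' (Option Γ')) :=
  (codeSupp c .halt).biUnion fun q ↦ TM2.stmts₁ (tr q)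

noncomputable def uSys (c : ToPartrec.Code) : Sys K' Γ' (Let Γ' (Option Γ') (stSet c)) :=
  sysOf tr (stSet c) (tr (trNormal c .halt)) none .main .cons .bit1

theorem uSys_spec (c : ToPartrec.Code) (n : ℕ) :
    (∃ u, Acc (uSys c) n u) ↔ (c.eval [2 ^ (n + 1) - 1]).Dom := by
  have hinit : init c [2 ^ (n + 1) - 1] =
      (⟨some (trNormal c .halt), none, initS K'.main Γ'.cons Γ'.bit1 n⟩ :
        TM2.Cfg (fun _ : K' => Γ') Λ' (Option Γ')) := by
    unfold init
    congr 1
    funext k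
    simp only [trList, trNat_ones, initS]
    cases k <;> simp [K'.elim]
  have hev : (c.eval [2 ^ (n + 1) - 1]).Dom ↔ (StateTransition.eval (TM2.step tr)
      (⟨some (trNormal c .halt), none, initS K'.main Γ'.cons Γ'.bit1 n⟩ :
        TM2.Cfg (fun _ : K' => Γ') Λ' (Option Γ'))).Dom := by
    have := tr_eval c [2 ^ (n + 1) - 1]
    rw [hinit] at this
    rw [this]
    rfl
  unfold uSys
  refine (acc_iff _ _ _ _ _ _ n).trans (Iff.trans ?_ hev.symm)
  constructor
  · rintro ⟨w, hp, hr⟩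
    refine (dom_some _ _ _ _).2 ?_
    exact sound _ _ _ _ _ _ w _ _ _ hp hr
  · intro h
    have := @complete _ _ _ _ _ _ tr (stSet c) (tr (trNormal c .halt)) none .main .cons .bit1
      ⟨trNormal c .halt⟩ _ (tr_supports c .halt) ?_ _ ?_ h
    · exact this
    · intro l hl x hx
      classical
      unfold stSet
      exact Finset.mem_biUnion.2 ⟨l, hl, hx⟩
    · exact Finset.some_mem_insertNone.2 (tr_supports c .halt).1

end Universal

end Ocfg

namespace Ocfg

section Final

/-- Discrete logarithm by unbounded search. -/
def lg (x : ℕ) : Part ℕ := Nat.rfind (fun k => (decide (x < 2 ^ k) : Part Bool))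

theorem lg_partrec : Partrec lg := by
  have hp : Primrec₂ (fun a b : ℕ => a ^ b) :=
    Primrec₂.unpaired'.1 Nat.Primrec.pow
  have h : Primrec₂ (fun (x k : ℕ) => decide (x < 2 ^ k)) := by
    have := Primrec.nat_lt.comp (Primrec.fst (α := ℕ) (β := ℕ))
      (hp.comp (Primrec.const 2) Primrec.snd)
    exact this.decide
  exact Partrec.rfind h.to_comp.partrec₂

theorem lg_ones (n : ℕ) : lg (2 ^ (n + 1) - 1) = Part.some (n + 1) := by
  have hpos : 0 < 2 ^ (n + 1) := by positivity
  rw [Part.eq_some_iff]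
  refine Nat.mem_rfind.2 ⟨?_, ?_⟩
  · simp
  · intro m hm
    have : 2 ^ m < 2 ^ (n + 1) := Nat.pow_lt_pow_right (by norm_num) hm
    simp
    omega

/-- A universal function reading `2 ^ (n + 1) - 1` as the code `n`. -/
def univ (x : ℕ) : Part ℕ :=
  (lg x).bind fun m => Nat.Partrec.Code.eval (Denumerable.ofNat Nat.Partrec.Code (m - 1)) 0

theorem univ_partrec : Partrec univ := by
  refine lg_partrec.bind ?_
  refine Nat.Partrec.Code.eval_part.comp ?_ (Computable.const 0)
  exact (Computable.ofNat Nat.Partrec.Code).comp (Primrec.pred.to_comp.comp Computable.snd)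

theorem exists_univ : ∃ c : Turing.ToPartrec.Code, ∀ n : ℕ,
    (c.eval [2 ^ (n + 1) - 1]).Dom ↔
      (Nat.Partrec.Code.eval (Denumerable.ofNat Nat.Partrec.Code n) 0).Dom := by
  obtain ⟨c, hc⟩ := Turing.ToPartrec.Code.exists_code (Nat.Partrec'.part_iff₁.2 univ_partrec)
  refine ⟨c, fun n => ?_⟩
  have := hc ⟨[2 ^ (n + 1) - 1], rfl⟩
  have h2 : c.eval [2 ^ (n + 1) - 1] = pure <$> univ (2 ^ (n + 1) - 1) := this
  rw [h2, univ, lg_ones, Part.bind_some]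
  rfl

theorem computable_replicate {α : Type} [Primcodable α] (a : α) :
    Computable (fun n : ℕ => List.replicate n a) := by
  have : Primrec (fun n : ℕ => (List.range n).map (fun _ => a)) :=
    Primrec.list_map Primrec.list_range (Primrec₂.const a)
  refine (this.of_eq fun n => ?_).to_comp
  simp

variable {K Γ L : Type} [Fintype K] [Fintype L]

theorem gram_computable (M : Sys K Γ L) : Computable (gram M) := by
  unfold gram varR
  refine Computable.list_cons.comp ?_ (Computable.const _)
  refine Computable.list_append.comp ?_ (Computable.const _)
  refine Computable.list_append.comp (Computable.const _) ?_
  refine Computable.list_cons.comp ?_ (Computable.list_cons.comp ?_ (Computable.const _))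
  · refine Computable.list_cons.comp (Computable.const _) ?_
    exact Computable.list_append.comp (computable_replicate _) (Computable.const _)
  · refine Computable.list_cons.comp (Computable.const _) ?_
    refine Computable.list_append.comp ?_ (Computable.const _)
    exact (computable_replicate _).comp (Primrec.succ.comp Primrec.succ).to_comp

end Final

end Ocfg

/-- It is undecidable whether a given oCFG has least parse
trees, i.e. whether for every string `w` the set `P_G(w)` is empty or has a
`≺_G`-least element. -/
theorem stmt19 :
    ¬ ComputablePred (fun g : List (List (List (ℕ ⊕ ℕ))) =>
        HasLeastTrees (decodeOCFG g)) := by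
  intro h
  obtain ⟨c, hc⟩ := exists_univ
  have hf : Computable (fun e : Nat.Partrec.Code => gram (uSys c) (Encodable.encode e)) :=
    (gram_computable (uSys c)).comp Computable.encode
  have h1 : ComputablePred (fun e : Nat.Partrec.Code =>
      HasLeastTrees (decodeOCFG (gram (uSys c) (Encodable.encode e)))) :=
    ComputablePred.computable_of_manyOneReducible ⟨_, hf, fun _ => Iff.rfl⟩ h
  refine ComputablePred.halting_problem 0 (h1.not.of_eq fun e => ?_)
  rw [gram_spec (uSys c) _ (fun h => h) (fun h => h), not_not, uSys_spec, hc,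
    Denumerable.ofNat_encode]
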